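/- arXiv:1912.09480 — 2 statements merged into one kernel-verified Lean document; each statement's English description precedes it below -/
import Mathlib

section
/- Let ⊢ be a regular entailment relation on a preordered commutative group G. If (A + b₁) ∪ ... ∪ (A + bₘ) ⊢ {bⱼ} for every j = 1, ..., m, then A ⊢ {0}. -/
open Finset Pointwise

/-- A regular entailment relation on a preordered commutative group `G`:
a relation between nonempty finite subsets of `G` satisfying weakening, cut,
`{a} ⊢ {b}` when `a ≤ b`, translation invariance, and regularity. -/
structure IsRegularEntailment {G : Type*} [AddCommGroup G] [Preorder G]
    [CovariantClass G G (· + ·) (· ≤ ·)] [DecidableEq G]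
    (r : Finset G → Finset G → Prop) : Prop where
  weaken : ∀ {A A' B B' : Finset G}, A'.Nonempty → B'.Nonempty →
    A' ⊆ A → B' ⊆ B → r A' B' → r A B
  cut : ∀ {A B : Finset G} (x : G), A.Nonempty → B.Nonempty →
    r (insert x A) B → r A (insert x B) → r A B
  of_le : ∀ {a b : G}, a ≤ b → r {a} {b}
  translate : ∀ {A B : Finset G} (x : G),
    r (A.image (· + x)) (B.image (· + x)) → r A B
  regular : ∀ a b x y : G, r {a + x, b + y} {a + b, x + y}

namespace IsRegularEntailment

variable {G : Type*} {r : Finset G → Finset G → Prop}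

/-- A set none of whose nonempty finite subsets entails `{c}`. -/
def Avoids (r : Finset G → Finset G → Prop) (c : G) (S : Set G) : Prop :=
  ∀ U : Finset G, U.Nonempty → (U : Set G) ⊆ S → ¬ r U {c}

theorem exists_maximal_avoids {c : G} {S : Set G} (hS : Avoids r c S) :
    ∃ M, S ⊆ M ∧ Maximal (Avoids r c) M := by
  refine zorn_subset_nonempty {T | Avoids r c T} (fun C hC hchain hne => ?_) S hS
  refine ⟨⋃₀ C, fun U hU hUC => ?_, fun T hT => Set.subset_sUnion_of_mem hT⟩
  obtain ⟨T, hT, hUT⟩ := hchain.directedOn.exists_mem_subset_of_finset_subset_biUnion hne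
    (f := id) (by simpa [Set.sUnion_eq_biUnion] using hUC)
  exact hC hT U hU hUT

variable [AddCommGroup G] [Preorder G] [CovariantClass G G (· + ·) (· ≤ ·)] [DecidableEq G]

theorem exists_entails_of_notMem {c : G} {M : Set G} (hM : Maximal (Avoids r c) M)
    (hr : IsRegularEntailment r) {W : Finset G} (hWM : (W : Set G) ⊆ M)
    {x : G} (hx : x ∉ M) :
    ∃ U : Finset G, W ⊆ U ∧ (U : Set G) ⊆ M ∧ r (insert x U) {c} := by
  have hnot : ¬ Avoids r c (insert x M) := fun h =>
    hx (hM.le_of_ge h (Set.subset_insert x M) (Set.mem_insert x M))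
  simp only [Avoids, not_forall, not_not] at hnot
  obtain ⟨U, hU, hUM, hUc⟩ := hnot
  refine ⟨W ∪ U.erase x, subset_union_left, ?_,
    hr.weaken hU (singleton_nonempty c) ?_ Subset.rfl hUc⟩
  · intro y hy
    rcases mem_union.1 (mem_coe.1 hy) with h | h
    · exact hWM h
    · exact (hUM (mem_of_mem_erase h)).resolve_left (ne_of_mem_erase h)
  · intro y hy
    by_cases h : y = x <;> simp [h, hy]

theorem mem_or_mem_of_entails {c : G} {M : Set G} (hr : IsRegularEntailment r)
    (hM : Maximal (Avoids r c) M) {W : Finset G} (hW : W.Nonempty) (hWM : (W : Set G) ⊆ M)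
    {x y : G} (h : r W {x, y}) : x ∈ M ∨ y ∈ M := by
  by_contra! hxy
  obtain ⟨U, hWU, hUM, hU⟩ := exists_entails_of_notMem hM hr hWM hxy.1
  obtain ⟨V, hUV, hVM, hV⟩ := exists_entails_of_notMem hM hr hUM hxy.2
  have hVne : V.Nonempty := (hW.mono hWU).mono hUV
  refine hM.prop V hVne hVM (hr.cut y hVne (singleton_nonempty c) hV ?_)
  refine hr.cut x hVne (insert_nonempty _ _) ?_ ?_
  · exact hr.weaken (insert_nonempty _ _) (singleton_nonempty c)
      (insert_subset_insert x hUV) (subset_insert _ _) hU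
  · exact hr.weaken hW (insert_nonempty _ _) (hWU.trans hUV)
      (insert_subset_insert x (by simp)) h

theorem forall_add_mem_or_forall_sub_mem {c : G} {M : Set G} (hr : IsRegularEntailment r)
    (hM : Maximal (Avoids r c) M) (t : G) :
    (∀ s ∈ M, s + t ∈ M) ∨ (∀ s ∈ M, s - t ∈ M) := by
  by_contra! h
  obtain ⟨⟨p, hp, hpt⟩, q, hq, hqt⟩ := h
  have hreg : r {p, q} {p + t, q - t} := by simpa using hr.regular p t 0 (q - t)
  rcases mem_or_mem_of_entails hr hM (insert_nonempty _ _)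
    (by simp [Set.insert_subset_iff, hp, hq]) hreg with h | h
  · exact hpt h
  · exact hqt h

end IsRegularEntailment

open IsRegularEntailment in
theorem regular_entailment_cancel {G : Type*} [AddCommGroup G] [Preorder G]
    [CovariantClass G G (· + ·) (· ≤ ·)] [DecidableEq G]
    (r : Finset G → Finset G → Prop) (hr : IsRegularEntailment r)
    (A B : Finset G) (hA : A.Nonempty) (hB : B.Nonempty)
    (h : ∀ b ∈ B, r (B.biUnion (fun b' => A.image (fun a => a + b'))) {b}) :
    r A {0} := by
  by_contra hA0
  obtain ⟨M, hAM, hM⟩ := exists_maximal_avoids (r := r) (c := 0) (S := A)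
    fun U hU hUA hU0 => hA0 (hr.weaken hU (singleton_nonempty 0) (mod_cast hUA) Subset.rfl hU0)
  obtain ⟨b, hb, hmax⟩ := B.exists_maximalFor (fun b => {s | s - b ∈ M}) hB
  have hshift : ∀ b' ∈ B, ∀ s ∈ M, s + b' - b ∈ M := by
    intro b' hb' s hs
    rcases forall_add_mem_or_forall_sub_mem hr hM (b' - b) with ht | ht
    · simpa [add_sub_assoc] using ht s hs
    · have hle : {s | s - b ∈ M} ⊆ {s | s - b' ∈ M} := fun u hu => by
        simpa using ht _ hu
      exact hmax hb' hle (show s + b' - b' ∈ M by simpa using hs)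
  refine hM.prop ((B.biUnion fun b' => A.image fun a => a + b').image (· - b)) ?_ ?_ ?_
  · exact (hB.biUnion fun _ _ => hA.image _).image _
  · intro u hu
    simp only [coe_image, Set.mem_image, mem_coe, mem_biUnion, mem_image] at hu
    obtain ⟨_, ⟨b', hb', a, ha, rfl⟩, rfl⟩ := hu
    exact hshift b' hb' a (hAM ha)
  · refine hr.translate b ?_
    simpa [image_image, Function.comp_def] using h b hb
end

section
/- Let S be an equivariant system of ideals on a preordered commutative group G such that U_x(S) = S for all x in G, where U_x(S) = T_x(S) ∩ T_{-x}(S) and T_x(S) is the least equivariant system of ideals containing S with T_x(S)({x}). Then S is regular, i.e., S additionally satisfies (P2): S(A + B) whenever S((A + B) ∪ A) and S((A + B) ∪ B), and (P5): S({x, -x}) for all x. -/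
open Finset Pointwise

/-- An equivariant system of ideals on a preordered commutative group,
presented as a predicate on (nonempty) finite subsets. -/
structure IsIdealSystem {G : Type*} [AddCommGroup G] [Preorder G]
    [CovariantClass G G (· + ·) (· ≤ ·)] [DecidableEq G]
    (S : Finset G → Prop) : Prop where
  p1 : ∀ {A A' : Finset G}, A'.Nonempty → A' ⊆ A → S A' → S A
  p2' : ∀ {A : Finset G} (u : G), A.Nonempty →
    S (insert u A) → S (A.image (fun a => a - u)) → S A
  p3 : ∀ {a : G}, a ≤ 0 → S {a}

/-- `Tx S x A`: the characterization of the least equivariant system of ideals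
containing `S` and forcing `x ▷ 0`. -/
def Tx {G : Type*} [AddCommGroup G] [DecidableEq G]
    (S : Finset G → Prop) (x : G) (A : Finset G) : Prop :=
  ∃ k : ℕ, S ((Finset.range (k + 1)).biUnion (fun j => A.image (fun a => a - j • x)))

section IdealSystems

variable {G : Type*} [AddCommGroup G] [DecidableEq G]

/-- The union of the translates `A - j • x` for `j ≤ k`. -/
def translates (x : G) (k : ℕ) (A : Finset G) : Finset G :=
  (Finset.range (k + 1)).biUnion (fun j => A.image (fun a => a - j • x))

lemma Tx_iff {S : Finset G → Prop} {x : G} {A : Finset G} :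
    Tx S x A ↔ ∃ k, S (translates x k A) := Iff.rfl

lemma mem_translates {x g : G} {k : ℕ} {A : Finset G} :
    g ∈ translates x k A ↔ ∃ j ≤ k, ∃ a ∈ A, a - j • x = g := by
  simp [translates]

lemma translates_mono {x : G} {k l : ℕ} {A B : Finset G} (hkl : k ≤ l) (hAB : A ⊆ B) :
    translates x k A ⊆ translates x l B := by
  intro g hg
  obtain ⟨j, hj, a, ha, rfl⟩ := mem_translates.1 hg
  exact mem_translates.2 ⟨j, hj.trans hkl, a, hAB ha, rfl⟩

lemma subset_translates (x : G) (k : ℕ) (A : Finset G) : A ⊆ translates x k A :=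
  fun a ha => mem_translates.2 ⟨0, k.zero_le, a, ha, by simp⟩

lemma translates_nonempty {x : G} {k : ℕ} {A : Finset G} (hA : A.Nonempty) :
    (translates x k A).Nonempty :=
  hA.mono (subset_translates x k A)

lemma translates_comm (x y : G) (k l : ℕ) (A : Finset G) :
    translates x k (translates y l A) = translates y l (translates x k A) := by
  ext g
  simp only [mem_translates]
  constructor
  · rintro ⟨j, hj, _, ⟨i, hi, a, ha, rfl⟩, rfl⟩
    exact ⟨i, hi, _, ⟨j, hj, a, ha, rfl⟩, by abel⟩
  · rintro ⟨j, hj, _, ⟨i, hi, a, ha, rfl⟩, rfl⟩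
    exact ⟨i, hi, _, ⟨j, hj, a, ha, rfl⟩, by abel⟩

variable [Preorder G] [CovariantClass G G (· + ·) (· ≤ ·)] {S : Finset G → Prop}

namespace IsIdealSystem

lemma of_mem (hS : IsIdealSystem S) {a : G} {A : Finset G} (ha : a ∈ A) (h : S {a}) : S A :=
  hS.p1 (Finset.singleton_nonempty a) (by simpa using ha) h

lemma zero (hS : IsIdealSystem S) : S {0} := hS.p3 le_rfl

lemma singleton_add (hS : IsIdealSystem S) {x y : G} (hx : S {x}) (hy : S {y}) :
    S {x + y} :=
  hS.p2' y (Finset.singleton_nonempty _) (hS.of_mem (by simp) hy) (by simpa using hx)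

lemma cut_union (hS : IsIdealSystem S) {X : Finset G} (hX : X.Nonempty) (D : Finset G)
    (h : S (X ∪ D)) (hD : ∀ d ∈ D, S (X.image (fun a => a - d))) : S X := by
  induction D using Finset.induction_on with
  | empty => simpa using h
  | insert d D _ ih =>
    refine ih (hS.p2' d (hX.mono Finset.subset_union_left) ?_ ?_)
      fun e he => hD e (Finset.mem_insert_of_mem he)
    · rwa [← Finset.union_insert]
    · exact hS.p1 (hX.image _) (Finset.image_subset_image Finset.subset_union_left)
        (hD d (Finset.mem_insert_self d D))

lemma of_union_of_dominated (hS : IsIdealSystem S) {X D : Finset G} (hX : X.Nonempty)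
    (h : S (X ∪ D)) (hD : ∀ d ∈ D, ∃ c ∈ X, S {c - d}) : S X := by
  refine hS.cut_union hX D h fun d hd => ?_
  obtain ⟨c, hc, hcd⟩ := hD d hd
  exact hS.of_mem (Finset.mem_image_of_mem _ hc) hcd

lemma Tx_of (hS : IsIdealSystem S) {x : G} {A : Finset G} (hA : A.Nonempty) (h : S A) :
    Tx S x A :=
  Tx_iff.2 ⟨0, hS.p1 hA (subset_translates x 0 A) h⟩

lemma Tx_of_mem (hS : IsIdealSystem S) {x : G} {A : Finset G} (hx : x ∈ A) : Tx S x A :=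
  Tx_iff.2 ⟨1, hS.of_mem (mem_translates.2 ⟨1, le_rfl, x, hx, by simp⟩) hS.zero⟩

protected lemma Tx (hS : IsIdealSystem S) (x : G) : IsIdealSystem (Tx S x) where
  p1 := by
    rintro A A' hA' hsub ⟨k, hk⟩
    exact ⟨k, hS.p1 (translates_nonempty hA') (translates_mono le_rfl hsub) hk⟩
  p2' := by
    rintro A u hA ⟨k, hk⟩ ⟨l, hl⟩
    refine Tx_iff.2 ⟨k + l, hS.cut_union (translates_nonempty hA) (translates x k {u}) ?_ ?_⟩
    · refine hS.p1 (translates_nonempty (Finset.insert_nonempty u A)) ?_ hk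
      intro g hg
      obtain ⟨j, hj, a, ha, rfl⟩ := mem_translates.1 hg
      rcases Finset.mem_insert.1 ha with rfl | ha
      · exact Finset.mem_union_right _
          (mem_translates.2 ⟨j, hj, _, Finset.mem_singleton_self _, rfl⟩)
      · exact Finset.mem_union_left _ (mem_translates.2 ⟨j, by omega, a, ha, rfl⟩)
    · intro d hd
      obtain ⟨j, hj, v, hv, rfl⟩ := mem_translates.1 hd
      obtain rfl := Finset.mem_singleton.1 hv
      refine hS.p1 (translates_nonempty (hA.image _)) ?_ hl
      intro g hg
      obtain ⟨i, hi, b, hb, rfl⟩ := mem_translates.1 hg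
      obtain ⟨a, ha, rfl⟩ := Finset.mem_image.1 hb
      refine Finset.mem_image.2
        ⟨_, mem_translates.2 ⟨j + i, by omega, a, ha, rfl⟩, ?_⟩
      rw [add_smul]
      abel
  p3 := fun ha => hS.Tx_of (Finset.singleton_nonempty _) (hS.p3 ha)

lemma Tx_Ux_fixed (hS : IsIdealSystem S)
    (hU : ∀ (x : G) (A : Finset G), A.Nonempty → Tx S x A → Tx S (-x) A → S A) (y : G)
    (x : G) (A : Finset G) (hA : A.Nonempty) (h₁ : Tx (Tx S y) x A)
    (h₂ : Tx (Tx S y) (-x) A) : Tx S y A := by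
  obtain ⟨k, l, h₁⟩ := h₁
  obtain ⟨m, n, h₂⟩ := h₂
  change S (translates y l (translates x k A)) at h₁
  change S (translates y n (translates (-x) m A)) at h₂
  rw [translates_comm] at h₁ h₂
  refine Tx_iff.2 ⟨max l n, hU x _ (translates_nonempty hA) (Tx_iff.2 ⟨k, ?_⟩)
    (Tx_iff.2 ⟨m, ?_⟩)⟩
  · exact hS.p1 (translates_nonempty (translates_nonempty hA))
      (translates_mono le_rfl (translates_mono (le_max_left l n) Finset.Subset.rfl)) h₁
  · exact hS.p1 (translates_nonempty (translates_nonempty hA))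
      (translates_mono le_rfl (translates_mono (le_max_right l n) Finset.Subset.rfl)) h₂

/-- To prove `S C` one may enlarge `S` so that the signs of finitely many elements are decided. -/
lemma of_forall_decided (hS : IsIdealSystem S)
    (hU : ∀ (x : G) (A : Finset G), A.Nonempty → Tx S x A → Tx S (-x) A → S A)
    {C : Finset G} (hC : C.Nonempty) (L : Finset G)
    (h : ∀ S' : Finset G → Prop, IsIdealSystem S' →
      (∀ A : Finset G, A.Nonempty → S A → S' A) → (∀ x ∈ L, S' {x} ∨ S' {-x}) → S' C) :
    S C := by
  induction L using Finset.induction_on generalizing S with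
  | empty => exact h S hS (fun _ _ hA => hA) (by simp)
  | insert x L _ ih =>
    refine hU x C hC
      (ih (hS.Tx x) (hS.Tx_Ux_fixed hU x) fun S' hS' hsub hL => ?_)
      (ih (hS.Tx (-x)) (hS.Tx_Ux_fixed hU (-x)) fun S' hS' hsub hL => ?_)
    · refine h S' hS' (fun A hA hSA => hsub A hA (hS.Tx_of hA hSA)) fun y hy => ?_
      rcases Finset.mem_insert.1 hy with rfl | hy
      · exact Or.inl (hsub _ (Finset.singleton_nonempty _)
          (hS.Tx_of_mem (Finset.mem_singleton_self _)))
      · exact hL y hy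
    · refine h S' hS' (fun A hA hSA => hsub A hA (hS.Tx_of hA hSA)) fun y hy => ?_
      rcases Finset.mem_insert.1 hy with rfl | hy
      · exact Or.inr (hsub _ (Finset.singleton_nonempty _)
          (hS.Tx_of_mem (Finset.mem_singleton_self _)))
      · exact hL y hy

lemma exists_least (hS : IsIdealSystem S) {A : Finset G} (hA : A.Nonempty)
    (h : ∀ a ∈ A, ∀ b ∈ A, S {a - b} ∨ S {b - a}) : ∃ m ∈ A, ∀ a ∈ A, S {m - a} := by
  induction hA using Finset.Nonempty.cons_induction with
  | singleton a => exact ⟨a, by simp, by simpa using hS.zero⟩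
  | cons a A ha hA ih =>
    obtain ⟨m, hm, hmA⟩ := ih fun b hb c hc =>
      h b (Finset.mem_cons_of_mem hb) c (Finset.mem_cons_of_mem hc)
    rcases h a (Finset.mem_cons_self a A) m (Finset.mem_cons_of_mem hm) with ham | hma
    · refine ⟨a, Finset.mem_cons_self a A, fun b hb => ?_⟩
      rcases Finset.mem_cons.1 hb with rfl | hb
      · simpa using hS.zero
      · simpa using hS.singleton_add ham (hmA b hb)
    · refine ⟨m, Finset.mem_cons_of_mem hm, fun b hb => ?_⟩
      rcases Finset.mem_cons.1 hb with rfl | hb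
      · exact hma
      · exact hmA b hb

lemma add_of_least_nonpos (hS : IsIdealSystem S) {A B : Finset G} {a b : G} (ha : a ∈ A)
    (hb : b ∈ B) (hleast : ∀ a' ∈ A, S {a - a'}) (hb0 : S {b}) (h : S ((A + B) ∪ A)) :
    S (A + B) := by
  refine hS.of_union_of_dominated ⟨_, Finset.add_mem_add ha hb⟩ h fun a' ha' =>
    ⟨a + b, Finset.add_mem_add ha hb, ?_⟩
  rw [add_sub_right_comm]
  exact hS.singleton_add (hleast a' ha') hb0

lemma add_of_least (hS : IsIdealSystem S) {A B : Finset G} {a b : G} (ha : a ∈ A)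
    (hb : b ∈ B) (hleastA : ∀ a' ∈ A, S {a - a'}) (hleastB : ∀ b' ∈ B, S {b - b'})
    (hsign : S {a} ∨ S {-a}) (hA : S ((A + B) ∪ A)) (hB : S ((A + B) ∪ B)) :
    S (A + B) := by
  rcases hsign with ha0 | ha0
  · rw [add_comm A B] at hB ⊢
    exact hS.add_of_least_nonpos hb ha hleastB ha0 hB
  · refine hS.add_of_least_nonpos ha hb hleastA ?_ hA
    refine hS.of_union_of_dominated (Finset.singleton_nonempty b)
      (hS.p1 ⟨b, Finset.mem_union_right _ hb⟩ Finset.subset_union_right hB) fun d hd =>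
      ⟨b, Finset.mem_singleton_self b, ?_⟩
    rcases Finset.mem_union.1 hd with hd | hd
    · obtain ⟨a', ha', b', hb', rfl⟩ := Finset.mem_add.1 hd
      have := hS.singleton_add (hS.singleton_add (hleastB b' hb') (hleastA a' ha')) ha0
      rwa [show b - b' + (a - a') + -a = b - (a' + b') by abel] at this
    · exact hleastB d hd

end IsIdealSystem

end IdealSystems

theorem regular_of_Ux_fixed {G : Type*} [AddCommGroup G] [Preorder G]
    [CovariantClass G G (· + ·) (· ≤ ·)] [DecidableEq G]
    (S : Finset G → Prop) (hS : IsIdealSystem S)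
    (hU : ∀ (x : G) (A : Finset G), A.Nonempty →
      ((Tx S x A ∧ Tx S (-x) A) ↔ S A)) :
    (∀ A B : Finset G, A.Nonempty → B.Nonempty →
      S ((A + B) ∪ A) → S ((A + B) ∪ B) → S (A + B)) ∧
    (∀ x : G, S {x, -x}) := by
  refine ⟨fun A B hA hB h₁ h₂ => ?_, fun x => (hU x _ (Finset.insert_nonempty _ _)).1
    ⟨hS.Tx_of_mem (by simp), hS.Tx_of_mem (by simp)⟩⟩
  refine hS.of_forall_decided (fun x A hA h h' => (hU x A hA).1 ⟨h, h'⟩) (hA.add hB)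
    (((A - A) ∪ (B - B)) ∪ A) fun S' hS' hsub hdec => ?_
  obtain ⟨a, ha, hleastA⟩ := hS'.exists_least hA fun a ha b hb => by
    simpa using hdec (a - b)
      (Finset.mem_union_left _ (Finset.mem_union_left _ (Finset.sub_mem_sub ha hb)))
  obtain ⟨b, hb, hleastB⟩ := hS'.exists_least hB fun a ha b hb => by
    simpa using hdec (a - b)
      (Finset.mem_union_left _ (Finset.mem_union_right _ (Finset.sub_mem_sub ha hb)))
  exact hS'.add_of_least ha hb hleastA hleastB (hdec a (Finset.mem_union_right _ ha))
    (hsub _ (hA.mono Finset.subset_union_right) h₁)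
    (hsub _ (hB.mono Finset.subset_union_right) h₂)
end
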